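/- arXiv:2305.02566 — 3 statements merged into one kernel-verified Lean document; each statement's English description precedes it below -/
import Mathlib

section
/- Let h ∈ ℝ[x₁,…,x_m] be hyperbolic with respect to e ∈ Γ₊₊, let v₁,…,vₙ ∈ Γ₊ and let Q ∈ ℝ^m. Then the polynomial p(x, z₁,…,zₙ) = h(xe + Σ_{i=1}^n zᵢvᵢ − Q) ∈ ℝ[x, z₁,…,zₙ] is real stable. -/
open MvPolynomial Finset
open scoped Classical

noncomputable section

/-- `h` is homogeneous of degree `d`, positive at `e`, and for every `x` the univariate
polynomial `t ↦ h (t • e - x)` factors with real roots `lam x 1 ≥ … ≥ lam x d`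
(the hyperbolic eigenvalues of `x`). -/
def IsHyperbolic {m d : ℕ} (h : MvPolynomial (Fin m) ℝ) (e : Fin m → ℝ)
    (lam : (Fin m → ℝ) → Fin d → ℝ) : Prop :=
  h.IsHomogeneous d ∧ 0 < eval e h ∧ (∀ x, Antitone (lam x)) ∧
    ∀ x : Fin m → ℝ, ∀ t : ℝ,
      eval (t • e - x) h = eval e h * ∏ i, (t - lam x i)

/-- hyperbolic trace: the sum of the hyperbolic eigenvalues. -/
def htrace {m d : ℕ} (lam : (Fin m → ℝ) → Fin d → ℝ) (x : Fin m → ℝ) : ℝ :=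
  ∑ i, lam x i

/-- hyperbolic rank: the number of nonzero hyperbolic eigenvalues. -/
def hrank {m d : ℕ} (lam : (Fin m → ℝ) → Fin d → ℝ) (x : Fin m → ℝ) : ℕ :=
  Nat.card {i : Fin d // lam x i ≠ 0}

/-- hyperbolic norm: the largest absolute value of a hyperbolic eigenvalue. -/
def hnorm {m d : ℕ} (lam : (Fin m → ℝ) → Fin d → ℝ) (x : Fin m → ℝ) : ℝ :=
  ⨆ i, |lam x i|

/-- closed hyperbolicity cone: all hyperbolic eigenvalues nonnegative. -/
def InCone {m d : ℕ} (lam : (Fin m → ℝ) → Fin d → ℝ) (x : Fin m → ℝ) : Prop :=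
  ∀ i, 0 ≤ lam x i

/-- open hyperbolicity cone: all hyperbolic eigenvalues positive. -/
def InOpenCone {m d : ℕ} (lam : (Fin m → ℝ) → Fin d → ℝ) (x : Fin m → ℝ) : Prop :=
  ∀ i, 0 < lam x i

/-- A real polynomial is real stable if it has no zero with all coordinates in the
open upper half plane. -/
def RealStable {k : ℕ} (p : MvPolynomial (Fin k) ℝ) : Prop :=
  ∀ z : Fin k → ℂ, (∀ i, 0 < (z i).im) → (aeval z p : ℂ) ≠ 0

open Polynomial in
/-- A complex polynomial of degree at most `d` whose roots all lie in the open lower half plane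
decays in a controlled way from `t + L * I` down to `t`. -/
lemma norm_eval_add_mul_I_le {d : ℕ} (f : ℂ[X]) (hd : f.natDegree ≤ d)
    (hf : ∀ t : ℂ, 0 ≤ t.im → f.eval t ≠ 0) {t : ℂ} (ht : 0 < t.im) {L : ℝ} (hL : 0 ≤ L) :
    ‖f.eval (t + L * Complex.I)‖ * (t.im / (t.im + L)) ^ d ≤ ‖f.eval t‖ := by
  set c := t.im / (t.im + L) with hc
  have hc0 : 0 ≤ c := by positivity
  have hc1 : c ≤ 1 := div_le_one_of_le₀ (by linarith) (by linarith)
  have hsplit := IsAlgClosed.splits f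
  have hroots : ∀ r ∈ f.roots, r.im < 0 := by
    intro r hr
    by_contra! h0
    exact hf r h0 (isRoot_of_mem_roots hr)
  have key : ∀ R : Multiset ℂ, (∀ r ∈ R, r.im < 0) →
      ‖(R.map (t + L * Complex.I - ·)).prod‖ * c ^ R.card ≤ ‖(R.map (t - ·)).prod‖ := by
    intro R
    induction R using Multiset.induction with
    | empty => simp
    | cons r R ih =>
      intro hR
      have hr : r.im < 0 := hR r (Multiset.mem_cons_self r R)
      have ih' := ih fun s hs => hR s (Multiset.mem_cons_of_mem hs)
      have h1 : t.im ≤ ‖t - r‖ := by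
        have := (le_abs_self _).trans (Complex.abs_im_le_norm (t - r))
        rw [Complex.sub_im] at this
        linarith
      have h2 : ‖t + L * Complex.I - r‖ ≤ ‖t - r‖ + L := by
        have : t + L * Complex.I - r = (t - r) + L * Complex.I := by ring
        rw [this]
        refine (norm_add_le _ _).trans ?_
        simp [abs_of_nonneg hL]
      have h3 : ‖t + L * Complex.I - r‖ * c ≤ ‖t - r‖ := by
        refine (mul_le_mul_of_nonneg_right h2 hc0).trans ?_
        rw [hc, mul_div_assoc', div_le_iff₀ (by linarith)]
        nlinarith
      simp only [Multiset.map_cons, Multiset.prod_cons, norm_mul, Multiset.card_cons, pow_succ]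
      calc _ = (‖t + L * Complex.I - r‖ * c) *
            (‖(R.map (t + L * Complex.I - ·)).prod‖ * c ^ R.card) := by ring
        _ ≤ _ := mul_le_mul h3 ih' (by positivity) (by positivity)
  have hcard : f.roots.card ≤ d := (card_roots' f).trans hd
  rw [hsplit.eval_eq_prod_roots, hsplit.eval_eq_prod_roots, norm_mul, norm_mul, mul_assoc]
  refine mul_le_mul_of_nonneg_left (le_trans ?_ (key f.roots hroots)) (norm_nonneg _)
  exact mul_le_mul_of_nonneg_left (pow_le_pow_of_le_one hc0 hc1 hcard) (norm_nonneg _)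

section HomogeneousPolynomial

variable {σ : Type*}

lemma MvPolynomial.IsHomogeneous.eval_smul_eq {R : Type*} [CommSemiring R] {d : ℕ}
    {g : MvPolynomial σ R} (hg : g.IsHomogeneous d) (c : R) (z : σ → R) :
    eval (c • z) g = c ^ d * eval z g := by
  rw [eval_eq, eval_eq, Finset.mul_sum]
  refine Finset.sum_congr rfl fun a ha => ?_
  have hdeg : ∑ i ∈ a.support, a i = d := by
    rw [← Finsupp.degree_apply, Finsupp.degree_eq_weight_one]
    exact hg (mem_support_iff.mp ha)
  simp only [Pi.smul_apply, smul_eq_mul, mul_pow, Finset.prod_mul_distrib,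
    Finset.prod_pow_eq_pow_sum, hdeg]
  ring

/-- The restriction of a multivariate polynomial to the line `t ↦ y + t • v`. -/
def lineRestriction (g : MvPolynomial σ ℂ) (y v : σ → ℂ) : Polynomial ℂ :=
  aeval (fun j => Polynomial.C (v j) * Polynomial.X + Polynomial.C (y j)) g

lemma eval_lineRestriction (g : MvPolynomial σ ℂ) (y v : σ → ℂ) (t : ℂ) :
    (lineRestriction g y v).eval t = eval (y + t • v) g := by
  unfold lineRestriction
  induction g using MvPolynomial.induction_on with
  | C a => simp
  | add p q hp hq => simp only [map_add, Polynomial.eval_add, hp, hq]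
  | mul_X p j hp =>
    rw [map_mul, Polynomial.eval_mul, hp]
    simp only [aeval_X, Polynomial.eval_add, Polynomial.eval_mul, Polynomial.eval_C,
      Polynomial.eval_X, map_mul, eval_X, Pi.add_apply, Pi.smul_apply, smul_eq_mul]
    ring

lemma natDegree_lineRestriction_le {d : ℕ} {g : MvPolynomial σ ℂ} (hg : g.IsHomogeneous d)
    (y v : σ → ℂ) : (lineRestriction g y v).natDegree ≤ d := by
  simpa [lineRestriction] using aeval_natDegree_le g hg.totalDegree_le _
    fun i => Polynomial.natDegree_linear_le (a := v i) (b := y i)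

variable [Fintype σ]

/-- Roots of a homogeneous polynomial along lines with direction `v` are uniformly bounded, as
long as the polynomial does not vanish at `v`. -/
lemma exists_forall_eval_add_smul_ne_zero {d : ℕ} {g : MvPolynomial σ ℂ}
    (hg : g.IsHomogeneous d) {K : Type*} [TopologicalSpace K] [CompactSpace K]
    {y : K → σ → ℂ} (hy : Continuous y) {v : σ → ℂ} (hv : eval v g ≠ 0) :
    ∃ R : ℝ, 0 < R ∧ ∀ k : K, ∀ t : ℂ, R < ‖t‖ → eval (y k + t • v) g ≠ 0 := by
  obtain ⟨M, hM⟩ := (isCompact_range hy).isBounded.exists_norm_le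
  have hopen : IsOpen {z : σ → ℂ | eval z g ≠ 0} :=
    isOpen_ne_fun g.continuous_eval continuous_const
  obtain ⟨δ, hδ, hball⟩ := Metric.isOpen_iff.mp hopen v hv
  refine ⟨(|M| + 1) / δ, by positivity, fun k t ht => ?_⟩
  have htpos : 0 < ‖t‖ := lt_trans (by positivity) ht
  have ht0 : t ≠ 0 := norm_pos_iff.mp htpos
  have heq : y k + t • v = t • (v + t⁻¹ • y k) := by
    rw [smul_add, smul_inv_smul₀ ht0, add_comm]
  rw [heq, hg.eval_smul_eq]
  refine mul_ne_zero (pow_ne_zero _ ht0) (hball ?_)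
  have hyk : ‖y k‖ < |M| + 1 := by
    have := hM (y k) ⟨k, rfl⟩
    have := le_abs_self M
    linarith
  rw [mem_ball_iff_norm, add_sub_cancel_left, norm_smul, norm_inv, inv_mul_lt_iff₀ htpos]
  rw [div_lt_iff₀ hδ] at ht
  linarith

/-- Along a path of lines on which a homogeneous polynomial has no real zeros, zeros cannot enter
the upper half plane. -/
lemma eval_add_smul_ne_zero_of_path {d : ℕ} {g : MvPolynomial σ ℂ}
    (hg : g.IsHomogeneous d) {y : unitInterval → σ → ℂ} (hy : Continuous y) {v : σ → ℂ}
    (hv : eval v g ≠ 0) (hreal : ∀ k, ∀ t : ℝ, eval (y k + (t : ℂ) • v) g ≠ 0)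
    (hzero : ∀ t : ℂ, 0 ≤ t.im → eval (y 0 + t • v) g ≠ 0) {t : ℂ} (ht : 0 ≤ t.im) :
    eval (y 1 + t • v) g ≠ 0 := by
  obtain ⟨R, hR, hbound⟩ := exists_forall_eval_add_smul_ne_zero hg hy hv
  set A : Set unitInterval := {k | ∀ t : ℂ, 0 ≤ t.im → eval (y k + t • v) g ≠ 0} with hA
  have hopen : IsOpen A := by
    have hS : IsClosed {p : unitInterval × Metric.closedBall (0 : ℂ) R |
        0 ≤ (p.2 : ℂ).im ∧ eval (y p.1 + (p.2 : ℂ) • v) g = 0} := by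
      refine IsClosed.and ?_ ?_
      · exact isClosed_le continuous_const (by fun_prop)
      · exact isClosed_eq (g.continuous_eval.comp (by fun_prop)) continuous_const
    have : CompactSpace (Metric.closedBall (0 : ℂ) R) :=
      isCompact_iff_compactSpace.mp (isCompact_closedBall 0 R)
    have himg := isClosedMap_fst_of_compactSpace _ hS
    convert himg.isOpen_compl using 1
    ext k
    simp only [hA, Set.mem_ofPred_eq, Set.mem_compl_iff, Set.mem_image, Prod.exists, not_exists]
    constructor
    · rintro hk k' s ⟨⟨h1, h2⟩, rfl⟩
      exact hk s h1 h2
    · intro hk s hs h0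
      have hsR : ‖s‖ ≤ R := by
        by_contra! hlt
        exact hbound k s hlt h0
      exact hk k ⟨s, by simpa using hsR⟩ ⟨⟨hs, h0⟩, rfl⟩
  have hclosed : IsClosed A := by
    rw [← isSeqClosed_iff_isClosed]
    intro u k hu huk s hs
    rcases hs.eq_or_lt with hs0 | hspos
    · have hsr : ((s.re : ℝ) : ℂ) = s := Complex.ext rfl (by simpa using hs0)
      rw [← hsr]
      exact hreal k s.re
    · set L : ℝ := R + 1
      have hL : 0 ≤ L := by positivity
      set s' : ℂ := s + L * Complex.I
      have hs' : eval (y k + s' • v) g ≠ 0 := by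
        apply hbound
        have h1 : s'.im = s.im + L := by simp [s']
        have h2 := (le_abs_self _).trans (Complex.abs_im_le_norm s')
        have h3 : L = R + 1 := rfl
        linarith
      have hlim : ∀ w : ℂ, Filter.Tendsto (fun n => ‖eval (y (u n) + w • v) g‖) Filter.atTop
          (nhds ‖eval (y k + w • v) g‖) := by
        intro w
        have hc : Continuous fun k => ‖eval (y k + w • v) g‖ :=
          (g.continuous_eval.comp (by fun_prop)).norm
        exact (hc.tendsto k).comp huk
      have hle := le_of_tendsto_of_tendsto' ((hlim s').mul_const ((s.im / (s.im + L)) ^ d))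
        (hlim s) fun n => by
          have := norm_eval_add_mul_I_le (lineRestriction g (y (u n)) v)
            (natDegree_lineRestriction_le hg _ _)
            (fun w hw => by rw [eval_lineRestriction]; exact hu n w hw) hspos hL
          simpa only [eval_lineRestriction] using this
      have hpos : 0 < ‖eval (y k + s' • v) g‖ * (s.im / (s.im + L)) ^ d :=
        mul_pos (norm_pos_iff.mpr hs') (pow_pos (div_pos hspos (by linarith)) d)
      exact norm_pos_iff.mp (hpos.trans_le hle)
  have huniv : A = Set.univ := IsClopen.eq_univ ⟨hclosed, hopen⟩ ⟨0, hzero⟩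
  exact (huniv ▸ Set.mem_univ 1 : (1 : unitInterval) ∈ A) t ht

end HomogeneousPolynomial

section Hyperbolic

variable {m d : ℕ} {h : MvPolynomial (Fin m) ℝ} {e : Fin m → ℝ} {lam : (Fin m → ℝ) → Fin d → ℝ}

/-- A real vector, viewed as a complex one. -/
def complexify (x : Fin m → ℝ) : Fin m → ℂ := fun j => (x j : ℂ)

@[simp]
lemma complexify_apply (x : Fin m → ℝ) (j : Fin m) : complexify x j = (x j : ℂ) := rfl

/-- The factorization of a hyperbolic polynomial persists for complex `t`. -/
lemma IsHyperbolic.eval_map_eq (hhyp : IsHyperbolic h e lam) (x : Fin m → ℝ) (t : ℂ) :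
    eval (t • complexify e - complexify x) (map (algebraMap ℝ ℂ) h)
      = (eval e h : ℂ) * ∏ i, (t - (lam x i : ℂ)) := by
  set g := map (algebraMap ℝ ℂ) h with hg
  set q : Polynomial ℂ := Polynomial.C (eval e h : ℂ) *
    ∏ i, (Polynomial.X - Polynomial.C (lam x i : ℂ)) with hq
  have hq_eval : ∀ s, q.eval s = (eval e h : ℂ) * ∏ i, (s - (lam x i : ℂ)) := by
    intro s
    simp [hq, Polynomial.eval_prod]
  have hreal : ∀ s : ℝ, (lineRestriction g (-complexify x) (complexify e)).eval (s : ℂ)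
      = q.eval (s : ℂ) := by
    intro s
    rw [eval_lineRestriction, hq_eval]
    have hpt : -complexify x + (s : ℂ) • complexify e
        = fun j => algebraMap ℝ ℂ ((s • e - x) j) := by
      ext j
      simp
      ring
    have hev : eval (fun j => algebraMap ℝ ℂ ((s • e - x) j)) g
        = algebraMap ℝ ℂ (eval (s • e - x) h) := by
      rw [hg, eval_map]
      exact (eval₂_comp (algebraMap ℝ ℂ) (s • e - x) h).symm
    rw [hpt, hev, hhyp.2.2.2 x s]
    simp
  have hpoly : lineRestriction g (-complexify x) (complexify e) = q := by
    refine Polynomial.eq_of_infinite_eval_eq _ _ ?_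
    refine (Set.infinite_range_of_injective Complex.ofReal_injective).mono ?_
    rintro _ ⟨s, rfl⟩
    exact hreal s
  rw [← hq_eval, ← hpoly, eval_lineRestriction, neg_add_eq_sub]

lemma IsHyperbolic.eval_map_ne_zero (hhyp : IsHyperbolic h e lam) (x : Fin m → ℝ) {t : ℂ}
    (ht : ∀ i, t ≠ lam x i) :
    eval (t • complexify e - complexify x) (map (algebraMap ℝ ℂ) h) ≠ 0 := by
  rw [hhyp.eval_map_eq]
  refine mul_ne_zero (by exact_mod_cast hhyp.2.1.ne') ?_
  exact Finset.prod_ne_zero_iff.mpr fun i _ => sub_ne_zero.mpr (ht i)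

lemma IsHyperbolic.eval_add_smul_ne_zero (hhyp : IsHyperbolic h e lam) (x : Fin m → ℝ) {s : ℝ}
    (hs : 0 < s) :
    eval (complexify x + (s * Complex.I) • complexify e) (map (algebraMap ℝ ℂ) h) ≠ 0 := by
  have := hhyp.eval_map_ne_zero (-x) (t := s * Complex.I) fun i hi => by
    have := congrArg Complex.im hi
    simp at this
    exact hs.ne' this
  convert this using 3
  ext j
  simp
  ring

/-- Shifting a vector of the closed cone by a positive multiple of `e`, no zeros occur in the
direction of the shifted vector. -/
lemma IsHyperbolic.eval_shift_ne_zero (hhyp : IsHyperbolic h e lam) {v : Fin m → ℝ}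
    (hv : InCone lam v) {ε : ℝ} (hε : 0 < ε) :
    eval (complexify (v + ε • e)) (map (algebraMap ℝ ℂ) h) ≠ 0 := by
  have := hhyp.eval_map_ne_zero v (t := -ε) fun i hi => by
    have hre := congrArg Complex.re hi
    simp at hre
    linarith [hv i]
  have heq : complexify (v + ε • e)
      = (-1 : ℂ) • ((-ε : ℂ) • complexify e - complexify v) := by
    ext j
    simp
  rw [heq, (hhyp.1.map _).eval_smul_eq]
  exact mul_ne_zero (pow_ne_zero _ (by norm_num)) this

lemma IsHyperbolic.eval_smul_add_smul_shift_ne_zero (hhyp : IsHyperbolic h e lam)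
    {v : Fin m → ℝ} (hv : InCone lam v) {ε : ℝ} (hε : 0 < ε) {s : ℝ} (hs : 0 < s) {t : ℂ}
    (ht : 0 ≤ t.im) :
    eval ((s * Complex.I) • complexify e + t • complexify (v + ε • e))
      (map (algebraMap ℝ ℂ) h) ≠ 0 := by
  rcases eq_or_ne t 0 with rfl | ht0
  · have := hhyp.eval_add_smul_ne_zero 0 hs
    convert this using 3
    ext j
    simp
  · have := hhyp.eval_map_ne_zero v (t := -(s * Complex.I / t + ε)) fun i hi => by
      have h1 : s * Complex.I = -((ε + lam v i : ℝ) : ℂ) * t := by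
        have h2 : s * Complex.I / t = -((ε + lam v i : ℝ) : ℂ) := by
          push_cast
          linear_combination -hi
        rw [← h2, div_mul_cancel₀ _ ht0]
      have him := congrArg Complex.im h1
      rw [← Complex.ofReal_neg, Complex.im_ofReal_mul, Complex.im_ofReal_mul] at him
      simp at him
      nlinarith [hv i]
    have heq : (s * Complex.I) • complexify e + t • complexify (v + ε • e)
        = (-t) • ((-(s * Complex.I / t + ε)) • complexify e - complexify v) := by
      ext j
      simp
      field_simp
      ring
    rw [heq, (hhyp.1.map _).eval_smul_eq]
    exact mul_ne_zero (pow_ne_zero _ (neg_ne_zero.mpr ht0)) this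

/-- `h` has no zeros with imaginary part `θ • w + s • e` for any `θ ≥ 0` and `s > 0`. -/
def NonvanishingDirection (h : MvPolynomial (Fin m) ℝ) (e w : Fin m → ℝ) : Prop :=
  ∀ (x : Fin m → ℝ) (s θ : ℝ), 0 < s → 0 ≤ θ →
    eval (complexify x + (θ * Complex.I) • complexify w + (s * Complex.I) • complexify e)
      (map (algebraMap ℝ ℂ) h) ≠ 0

lemma NonvanishingDirection.add_smul_shift (hhyp : IsHyperbolic h e lam) {w : Fin m → ℝ}
    (hw : NonvanishingDirection h e w) {v : Fin m → ℝ} (hv : InCone lam v) {ε β : ℝ}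
    (hε : 0 < ε) (hβ : 0 ≤ β) : NonvanishingDirection h e (w + β • (v + ε • e)) := by
  intro x s θ hs hθ
  set y : unitInterval → Fin m → ℂ := fun k =>
    ((k : ℝ) : ℂ) • complexify x + (((k : ℝ) * θ : ℝ) * Complex.I) • complexify w
      + (s * Complex.I) • complexify e with hy
  have hcont : Continuous y := by
    simp only [hy]
    fun_prop
  have := eval_add_smul_ne_zero_of_path (hhyp.1.map (algebraMap ℝ ℂ)) hcont
    (hhyp.eval_shift_ne_zero hv hε) (fun k t => ?_) (fun t ht => ?_)
    (t := (θ * β : ℝ) * Complex.I) (by simp; positivity)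
  · convert this using 3
    ext j
    simp [hy]
    ring
  · have := hw ((k : ℝ) • x + t • (v + ε • e)) s ((k : ℝ) * θ) hs (mul_nonneg k.2.1 hθ)
    convert this using 3
    ext j
    simp [hy]
    ring
  · have := hhyp.eval_smul_add_smul_shift_ne_zero hv hε hs ht
    convert this using 3
    ext j
    simp [hy]

lemma IsHyperbolic.nonvanishingDirection_sum (hhyp : IsHyperbolic h e lam) {ι : Type*}
    (S : Finset ι) {v : ι → Fin m → ℝ} (hv : ∀ i, InCone lam (v i)) {ε : ℝ} (hε : 0 < ε)
    {β : ι → ℝ} (hβ : ∀ i, 0 ≤ β i) :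
    NonvanishingDirection h e (∑ i ∈ S, β i • (v i + ε • e)) := by
  induction S using Finset.induction with
  | empty =>
    intro x s θ hs _
    have := hhyp.eval_add_smul_ne_zero x hs
    convert this using 3
    ext j
    simp
  | insert a S ha ih =>
    rw [Finset.sum_insert ha, add_comm]
    exact ih.add_smul_shift hhyp (hv a) hε (hβ a)

end Hyperbolic

/-- Linear restriction of a hyperbolic polynomial to directions in the hyperbolicity
cone is real stable. -/
theorem linear_restriction_real_stable
    {m d n : ℕ} (h : MvPolynomial (Fin m) ℝ) (e : Fin m → ℝ)
    (lam : (Fin m → ℝ) → Fin d → ℝ)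
    (hhyp : IsHyperbolic h e lam) (he : InOpenCone lam e)
    (v : Fin n → Fin m → ℝ) (hv : ∀ i, InCone lam (v i))
    (Q : Fin m → ℝ) :
    RealStable (aeval (fun j : Fin m =>
      X (0 : Fin (n + 1)) * C (e j)
        + (∑ i : Fin n, X i.succ * C (v i j)) - C (Q j)) h) := by
  intro z hz
  set B : ℝ := ∑ i : Fin n, (z i.succ).im with hB
  have hB0 : 0 ≤ B := Finset.sum_nonneg fun i _ => (hz i.succ).le
  set ε : ℝ := (z 0).im / (1 + B) with hε_def
  have hε : 0 < ε := div_pos (hz 0) (by linarith)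
  have hεB : (z 0).im = ε + ε * B := by
    rw [hε_def]
    field_simp
  have key := hhyp.nonvanishingDirection_sum Finset.univ hv hε (fun i => (hz (Fin.succ i)).le)
    ((z 0).re • e + ∑ i : Fin n, (z i.succ).re • v i - Q) ε 1 hε zero_le_one
  rw [← AlgHom.comp_apply, comp_aeval, aeval_def, ← eval_map]
  convert key using 3
  ext j
  have hsum : ∑ i : Fin n, z i.succ * (v i j : ℂ)
      = ((∑ i : Fin n, (z i.succ).re * v i j : ℝ) : ℂ)
        + ((∑ i : Fin n, (z i.succ).im * v i j : ℝ) : ℂ) * Complex.I := by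
    push_cast
    rw [Finset.sum_mul, ← Finset.sum_add_distrib]
    refine Finset.sum_congr rfl fun i _ => ?_
    conv_lhs => rw [← Complex.re_add_im (z i.succ)]
    ring
  have hshift : ∑ i : Fin n, (z i.succ).im * (v i j + ε * e j)
      = ∑ i : Fin n, (z i.succ).im * v i j + B * (ε * e j) := by
    simp only [mul_add, Finset.sum_add_distrib, hB, Finset.sum_mul]
  have hz0 : z 0 = (z 0).re + ((ε + ε * B : ℝ) : ℂ) * Complex.I := by
    rw [← hεB, Complex.re_add_im]
  have hlhs : (aeval z) (X (0 : Fin (n + 1)) * C (e j)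
        + (∑ i : Fin n, X i.succ * C (v i j)) - C (Q j))
      = z 0 * (e j : ℂ) + ∑ i : Fin n, z i.succ * (v i j : ℂ) - (Q j : ℂ) := by
    simp
  have hrhs : (complexify ((z 0).re • e + ∑ i : Fin n, (z i.succ).re • v i - Q)
        + (((1 : ℝ) : ℂ) * Complex.I) • complexify (∑ i : Fin n, (z i.succ).im • (v i + ε • e))
        + ((ε : ℂ) * Complex.I) • complexify e) j
      = (((z 0).re * e j + ∑ i : Fin n, (z i.succ).re * v i j - Q j : ℝ) : ℂ)
        + Complex.I * ((∑ i : Fin n, (z i.succ).im * (v i j + ε * e j) : ℝ) : ℂ)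
        + ε * Complex.I * e j := by
    simp [mul_add]
  rw [hlhs, hrhs, hsum, hshift, hz0]
  push_cast
  simp
  ring
end
end

section
/- Let h ∈ ℝ[x₁,…,x_m] be hyperbolic with respect to e, and let v₁,…,vₙ ∈ ℝ^m be vectors with rank_h(vᵢ) ≤ 1 for all i ∈ [n]. Then for any x ∈ ℝ^m and either choice of sign, h(x ± Σ_{i=1}^n vᵢ) = ∏_{i=1}^n (1 ± ∂_{zᵢ}) h(x + Σ_{i=1}^n zᵢvᵢ)|_{z=0}; furthermore, for any subset S ⊆ [n], h(x ± Σ_{i∈S} vᵢ) = ∏_{i∈S} (1 ± ∂_{zᵢ}) h(x + Σ_{i=1}^n zᵢvᵢ)|_{z=0}. -/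
open MvPolynomial Finset
open scoped Classical

noncomputable section

/-- the `n`-variate polynomial `h (x + ∑ i, z i • v i)` in the variables `z i = X i`. -/
def zPoly {m n : ℕ} (h : MvPolynomial (Fin m) ℝ) (x : Fin m → ℝ)
    (v : Fin n → Fin m → ℝ) : MvPolynomial (Fin n) ℝ :=
  aeval (fun j : Fin m => C (x j) + ∑ i : Fin n, X i * C (v i j)) h

/-- apply the operator `∏_{i ∈ L} (1 + ε ∂_{z i})`. -/
def opSign {n : ℕ} (ε : ℝ) (L : List (Fin n)) (P : MvPolynomial (Fin n) ℝ) :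
    MvPolynomial (Fin n) ℝ :=
  L.foldl (fun Q i => Q + C ε * pderiv i Q) P

namespace Polynomial
lemma degree_le_degree_of_abs_eval_le {p q : ℝ[X]} (h : ∀ s, |p.eval s| ≤ |q.eval s|) :
    p.degree ≤ q.degree := by
  by_contra! hlt
  have hp : p ≠ 0 := by rintro rfl; simp at hlt
  have ht := (div_tendsto_atTop_zero_of_degree_lt q p hlt).abs
  rw [abs_zero] at ht
  obtain ⟨s, hs, hs0⟩ := ((ht.eventually (gt_mem_nhds one_pos)).and
    (eventually_atTop_not_isRoot p hp)).exists
  rw [abs_div, div_lt_one (abs_pos.2 hs0)] at hs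
  exact (h s).not_gt hs

lemma leadingCoeff_nonneg_of_forall_eval_nonneg {p : ℝ[X]} (h : ∀ s, 0 ≤ p.eval s) :
    0 ≤ p.leadingCoeff := by
  by_contra! hlt
  by_cases hd : 0 < p.degree
  · obtain ⟨s, hs⟩ := ((p.tendsto_atBot_of_leadingCoeff_nonpos hd hlt.le).eventually
      (Filter.eventually_lt_atBot 0)).exists
    exact (h s).not_gt hs
  · have hc := eq_C_of_degree_le_zero (not_lt.1 hd)
    have := h 0
    rw [hc] at this hlt
    simp at this hlt
    linarith

lemma even_natDegree_of_forall_eval_nonneg {p : ℝ[X]} (h : ∀ s, 0 ≤ p.eval s) :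
    Even p.natDegree := by
  by_contra hodd
  rw [Nat.not_even_iff_odd] at hodd
  have h1 := leadingCoeff_nonneg_of_forall_eval_nonneg h
  have h2 := leadingCoeff_nonneg_of_forall_eval_nonneg (p := p.comp (-X)) fun s => by
    simpa using h (-s)
  rw [leadingCoeff_comp (by simp), leadingCoeff_neg, leadingCoeff_X, hodd.neg_one_pow] at h2
  have h3 : p.leadingCoeff = 0 := by linarith
  rw [leadingCoeff_eq_zero.1 h3] at hodd
  simp at hodd

/-- A polynomial whose values, divided by `s ^ n`, converge at infinity has degree at most `n`. -/
lemma of_tendsto_eval_div_pow {p : ℝ[X]} {n : ℕ} {L : ℝ}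
    (h : Filter.Tendsto (fun s => p.eval s / s ^ n) Filter.atTop (nhds L)) :
    p.natDegree ≤ n ∧ p.coeff n = L := by
  have key : (p - C L * X ^ n).degree < (X ^ n : ℝ[X]).degree := by
    rw [← div_tendsto_atTop_zero_iff_degree_lt _ _ (pow_ne_zero _ X_ne_zero)]
    have h' := h.sub_const L
    rw [sub_self] at h'
    refine h'.congr' ?_
    filter_upwards [Filter.eventually_gt_atTop 0] with s hs
    have : s ^ n ≠ 0 := (pow_pos hs n).ne'
    simp only [eval_sub, eval_mul, eval_C, eval_pow, eval_X]
    field_simp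
  rw [degree_X_pow] at key
  have hc : ∀ k, n ≤ k → p.coeff k = (C L * X ^ n).coeff k := fun k hk => by
    have := coeff_eq_zero_of_degree_lt (key.trans_le (by exact_mod_cast hk : (n : WithBot ℕ) ≤ k))
    rwa [coeff_sub, sub_eq_zero] at this
  refine ⟨natDegree_le_iff_coeff_eq_zero.2 fun k hk => ?_, ?_⟩
  · rw [hc k hk.le]; simp [coeff_X_pow, hk.ne']
  · rw [hc n le_rfl]; simp

lemma Splits.exists_fin_prod {p : ℝ[X]} (hp : p.Splits) {d : ℕ} (hd : p.natDegree = d) :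
    ∃ r : Fin d → ℝ, p = C p.leadingCoeff * ∏ i, (X - C (r i)) := by
  have h1 := hp.eq_prod_roots
  have h2 := hp.natDegree_eq_card_roots
  obtain ⟨l, hl⟩ := Quot.exists_rep p.roots
  rw [← hl] at h1 h2
  have h3 : l.length = d := by rw [← hd, h2]; rfl
  subst h3
  refine ⟨l.get, h1.trans ?_⟩
  congr 1
  rw [← List.prod_ofFn]
  change (List.map (fun x => X - C x) l).prod = _
  rw [← List.ofFn_getElem_eq_map]
  rfl

/-- Rolle: the derivative of a real-rooted polynomial is real-rooted. -/
lemma Splits.derivative_real {p : ℝ[X]} (hp : p.Splits) : (derivative p).Splits := by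
  rw [splits_iff_card_roots]
  refine le_antisymm (card_roots' _) ?_
  have h1 := card_roots_le_derivative p
  have h2 := hp.natDegree_eq_card_roots
  have h3 := natDegree_derivative_le p
  omega

section RootProducts

variable {ι : Type*} (r : ι → ℝ)

lemma sum_sq_erase_prod [DecidableEq ι] (S : Finset ι) :
    ∑ l ∈ S, (∏ j ∈ S.erase l, r j) ^ 2 =
      (∏ i ∈ S, (X - C (r i))).coeff 1 ^ 2 -
        2 * (∏ i ∈ S, (X - C (r i))).coeff 0 * (∏ i ∈ S, (X - C (r i))).coeff 2 := by
  induction S using Finset.induction_on with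
  | empty => simp [coeff_one]
  | insert a S ha ih =>
    have h0 : (∏ i ∈ S, (X - C (r i))).coeff 0 ^ 2 = (∏ i ∈ S, r i) ^ 2 := by
      rw [coeff_zero_eq_eval_zero, eval_prod, ← Finset.prod_pow, ← Finset.prod_pow]
      simp
    have h1 : ∑ l ∈ S, (∏ j ∈ (insert a S).erase l, r j) ^ 2 =
        r a ^ 2 * ∑ l ∈ S, (∏ j ∈ S.erase l, r j) ^ 2 := by
      rw [Finset.mul_sum]
      refine Finset.sum_congr rfl fun l hl => ?_
      rw [Finset.erase_insert_of_ne (by rintro rfl; exact ha hl),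
        Finset.prod_insert (fun h => ha (Finset.mem_of_mem_erase h)), mul_pow]
    rw [Finset.sum_insert ha, Finset.erase_insert ha, Finset.prod_insert ha, h1, ih, ← h0, sub_mul]
    generalize ∏ i ∈ S, (X - C (r i)) = P
    have e1 : (X * P).coeff 1 = P.coeff 0 := coeff_X_mul P 0
    have e2 : (X * P).coeff 2 = P.coeff 1 := coeff_X_mul P 1
    simp only [coeff_sub, coeff_C_mul, e1, e2, mul_coeff_zero, coeff_X_zero, coeff_C_zero]
    ring

lemma sum_eq_neg_coeff_and_sum_sq_eq (S : Finset ι) :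
    (X ^ 2 * ∏ i ∈ S, (X - C (r i))).coeff (#S + 2) = 1 ∧
    (X ^ 2 * ∏ i ∈ S, (X - C (r i))).coeff (#S + 1) = -∑ i ∈ S, r i ∧
      ∑ i ∈ S, r i ^ 2 = (X ^ 2 * ∏ i ∈ S, (X - C (r i))).coeff (#S + 1) ^ 2 -
        2 * (X ^ 2 * ∏ i ∈ S, (X - C (r i))).coeff #S := by
  induction S using Finset.induction_on with
  | empty => simp [coeff_X_pow]
  | insert a S ha ih =>
    rw [Finset.prod_insert ha, Finset.sum_insert ha, Finset.sum_insert ha,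
      Finset.card_insert_of_notMem ha, mul_left_comm, sub_mul]
    have hd : (X ^ 2 * ∏ i ∈ S, (X - C (r i))).coeff (#S + 3) = 0 := by
      rw [show #S + 3 = #S + 1 + 2 from rfl, coeff_X_pow_mul]
      exact coeff_eq_zero_of_natDegree_lt (by simp)
    generalize X ^ 2 * ∏ i ∈ S, (X - C (r i)) = P at ih hd ⊢
    obtain ⟨h1, h2, h3⟩ := ih
    simp only [coeff_sub, coeff_C_mul, coeff_X_mul]
    rw [h3, show #S + 1 + 1 = #S + 2 from rfl, show #S + 1 + 2 = #S + 3 from rfl,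
      show #S + 2 + 1 = #S + 3 from rfl, hd, h1, h2]
    refine ⟨by ring, by ring, by ring⟩

lemma sq_sum_mul_prod_pow_le {n : ℕ} (r : Fin (n + 3) → ℝ) :
    (∑ i, r i) ^ 2 * (∏ i, r i) ^ (2 * (n + 1)) ≤
      (n + 3) ^ 2 * (∑ l, (∏ j ∈ univ.erase l, r j) ^ 2) ^ (n + 2) := by
  set W := ∑ l, (∏ j ∈ univ.erase l, r j) ^ 2 with hW
  set P := ∏ i, r i with hP
  have hW0 : 0 ≤ W := Finset.sum_nonneg fun _ _ => sq_nonneg _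
  by_cases h0 : P = 0
  · rw [h0, zero_pow (by omega), mul_zero]; positivity
  have hr : ∀ i, r i ≠ 0 := fun i => (Finset.prod_ne_zero_iff.1 h0) i (mem_univ i)
  have hw : ∀ l, ∏ j ∈ univ.erase l, r j = P / r l := fun l => by
    rw [eq_div_iff (hr l), Finset.prod_erase_mul _ _ (mem_univ l)]
  have hi : ∀ i, (r i * P ^ (n + 1)) ^ 2 ≤ W ^ (n + 2) := fun i => by
    have e : r i * P ^ (n + 1) = ∏ l ∈ univ.erase i, ∏ j ∈ univ.erase l, r j := by
      simp only [hw]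
      rw [Finset.prod_div_distrib, hw, Finset.prod_const, Finset.card_erase_of_mem (mem_univ i)]
      have := hr i
      simp only [card_univ, Fintype.card_fin, Nat.add_succ_sub_one]
      field_simp
      ring
    rw [e, ← Finset.prod_pow]
    refine (Finset.prod_le_prod (g := fun _ => W) (fun _ _ => sq_nonneg _) fun l _ =>
      Finset.single_le_sum (f := fun l => (∏ j ∈ univ.erase l, r j) ^ 2)
        (fun _ _ => sq_nonneg _) (mem_univ l)).trans ?_
    simp
  have h1 : (∑ i, r i) ^ 2 * P ^ (2 * (n + 1)) = (∑ i, r i * P ^ (n + 1)) ^ 2 := by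
    rw [← Finset.sum_mul]; ring
  rw [h1]
  refine (sq_sum_le_card_mul_sum_sq).trans ?_
  have h2 := Finset.sum_le_card_nsmul univ _ _ fun i _ => hi i
  simp only [card_univ, Fintype.card_fin, nsmul_eq_mul] at h2 ⊢
  push_cast at h2 ⊢
  nlinarith

end RootProducts

section RealRootedFamily

/-! Families `F ∈ ℝ[s][t]` such that `t ↦ F(s, t)` is real-rooted of degree `d` for all real `s`. -/

variable {F : ℝ[X][X]} {c : ℝ}

lemma exists_roots_of_map_splits {d : ℕ} (hc : c ≠ 0) (hd : F.natDegree ≤ d)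
    (hlead : F.coeff d = C c) {s : ℝ} (hs : (F.map (evalRingHom s)).Splits) :
    ∃ r : Fin d → ℝ, F.map (evalRingHom s) = C c * ∏ i, (X - C (r i)) := by
  have hcoeff : (F.map (evalRingHom s)).coeff d = c := by simp [hlead]
  have hnat : (F.map (evalRingHom s)).natDegree = d :=
    le_antisymm ((natDegree_map_le).trans hd) (le_natDegree_of_ne_zero (by rwa [hcoeff]))
  obtain ⟨r, hr⟩ := hs.exists_fin_prod hnat
  refine ⟨r, ?_⟩
  rwa [leadingCoeff, hnat, hcoeff] at hr

lemma natDegree_coeff_zero_eq_zero {n : ℕ} (hc : c ≠ 0)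
    (hF : ∀ s, ∃ r : Fin (n + 2) → ℝ, F.map (evalRingHom s) = C c * ∏ i, (X - C (r i)))
    (h1 : (F.coeff (n + 1)).natDegree = 0) (h2 : (F.coeff n).natDegree ≤ 1) :
    (F.coeff 0).natDegree = 0 := by
  choose r hr using hF
  have hcoeff : ∀ s k, (F.coeff k).eval s = c * (∏ i, (X - C (r s i))).coeff k := fun s k => by
    rw [← coeff_C_mul, ← hr, coeff_map, coe_evalRingHom]
  set R : ℝ[X] := F.coeff (n + 1) ^ 2 - C (2 * c) * F.coeff n with hR
  have hRs : ∀ s, R.eval s = c ^ 2 * ∑ i, r s i ^ 2 := fun s => by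
    obtain ⟨e1, -, e2⟩ := sum_eq_neg_coeff_and_sum_sq_eq (r s) univ
    simp only [card_univ, Fintype.card_fin, coeff_X_pow_mul,
      show n + 2 + 1 = n + 1 + 2 from rfl] at e1 e2
    rw [e2, hR]
    simp only [eval_sub, eval_pow, eval_mul, eval_C, hcoeff]
    ring
  have hR1 : R.natDegree ≤ 1 := by
    refine (natDegree_sub_le _ _).trans (max_le ?_ ((natDegree_C_mul_le _ _).trans h2))
    rw [natDegree_pow, h1]; omega
  have hR0 : R.natDegree = 0 := by
    have := even_natDegree_of_forall_eval_nonneg (p := R) fun s => by rw [hRs]; positivity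
    interval_cases R.natDegree
    · rfl
    · simp at this
  obtain ⟨ρ, hρ⟩ := natDegree_eq_zero.1 hR0
  have hbound : ∀ s i, r s i ^ 2 ≤ ρ / c ^ 2 := fun s i => by
    rw [le_div_iff₀ (by positivity), mul_comm]
    have := hRs s
    rw [← hρ, eval_C] at this
    rw [this]
    exact mul_le_mul_of_nonneg_left
      (Finset.single_le_sum (f := fun i => r s i ^ 2) (fun _ _ => sq_nonneg _) (mem_univ i))
      (sq_nonneg c)
  have hdeg := natDegree_le_natDegree <| degree_le_degree_of_abs_eval_le (p := F.coeff 0 ^ 2)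
    (q := C (c ^ 2 * (ρ / c ^ 2) ^ (n + 2))) fun s => by
      refine le_trans ?_ (le_abs_self _)
      rw [eval_pow, hcoeff, abs_of_nonneg (sq_nonneg _), mul_pow, eval_C, coeff_zero_eq_eval_zero,
        eval_prod, ← Finset.prod_pow]
      refine mul_le_mul_of_nonneg_left ?_ (sq_nonneg c)
      simp only [eval_sub, eval_X, eval_C, zero_sub, neg_sq]
      refine (Finset.prod_le_prod (fun _ _ => sq_nonneg _) fun i _ => hbound s i).trans_eq ?_
      rw [prod_const, card_univ, Fintype.card_fin]
  rw [natDegree_pow, natDegree_C] at hdeg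
  omega

lemma natDegree_coeff_zero_le_one {n : ℕ}
    (hF : ∀ s, ∃ r : Fin (n + 3) → ℝ, F.map (evalRingHom s) = C c * ∏ i, (X - C (r i)))
    (h1 : (F.coeff (n + 2)).natDegree = 1)
    (hle : ∀ k ≠ 0, (F.coeff k).natDegree ≤ 1) (h0 : n = 0 → (F.coeff 0).natDegree ≤ 2) :
    (F.coeff 0).natDegree ≤ 1 := by
  choose r hr using hF
  have hcoeff : ∀ s k, (F.coeff k).eval s = c * (∏ i, (X - C (r s i))).coeff k := fun s k => by
    rw [← coeff_C_mul, ← hr, coeff_map, coe_evalRingHom]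
  set Q : ℝ[X] := F.coeff 1 ^ 2 - 2 * F.coeff 0 * F.coeff 2 with hQ
  have hQs : ∀ s, Q.eval s = c ^ 2 * ∑ l, (∏ j ∈ univ.erase l, r s j) ^ 2 := fun s => by
    rw [sum_sq_erase_prod, hQ]
    simp only [eval_sub, eval_pow, eval_mul, eval_ofNat, hcoeff]
    ring
  by_contra! hlt
  set δ := (F.coeff 0).natDegree with hδ
  have hsq : (F.coeff 1 ^ 2).natDegree ≤ 2 := by
    rw [natDegree_pow]; have := hle 1 (by norm_num); omega
  have h20 : (2 * F.coeff 0 : ℝ[X]).natDegree = δ := by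
    rw [show (2 : ℝ[X]) = C 2 from rfl, natDegree_C_mul two_ne_zero]
  have hne0 : F.coeff 0 ≠ 0 := fun h => by simp [hδ, h] at hlt
  have hne1 : F.coeff (n + 2) ≠ 0 := fun h => by simp [h] at h1
  rcases Nat.eq_zero_or_pos n with rfl | hn
  · have h3 : Q.natDegree = δ + 1 := by
      have e : (2 * F.coeff 0 * F.coeff 2).natDegree = δ + 1 := by
        rw [natDegree_mul, h20, h1]
        · exact mul_ne_zero two_ne_zero hne0
        · exact hne1
      rw [hQ, natDegree_sub_eq_right_of_natDegree_lt (by omega), e]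
    have h4 := even_natDegree_of_forall_eval_nonneg (p := Q) fun s => by rw [hQs]; positivity
    rw [h3, show δ = 2 from le_antisymm (h0 rfl) hlt] at h4
    exact absurd h4 (by decide)
  · have hQd : Q.natDegree ≤ δ + 1 := by
      refine (natDegree_sub_le _ _).trans (max_le (by omega) (natDegree_mul_le.trans ?_))
      have := hle 2 (by norm_num)
      omega
    have hdeg := natDegree_le_natDegree <| degree_le_degree_of_abs_eval_le
      (p := F.coeff (n + 2) ^ 2 * F.coeff 0 ^ (2 * (n + 1)))
      (q := C ((n + 3) ^ 2 : ℝ) * Q ^ (n + 2)) fun s => by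
        refine le_trans ?_ (le_abs_self _)
        have e1 : (∏ i, (X - C (r s i))).coeff (n + 2) = -∑ i, r s i := by
          simpa using prod_X_sub_C_coeff_card_pred univ (r s) (by simp)
        have e2 : ((∏ i, (X - C (r s i))).coeff 0) ^ (2 * (n + 1)) =
            (∏ i, r s i) ^ (2 * (n + 1)) := by
          rw [pow_mul, pow_mul, coeff_zero_eq_eval_zero, eval_prod, ← Finset.prod_pow (n := 2),
            ← Finset.prod_pow (n := 2)]
          simp
        have h := mul_le_mul_of_nonneg_left (sq_sum_mul_prod_pow_le (r s))
          (pow_nonneg (sq_nonneg c) (n + 2))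
        simp only [eval_mul, eval_pow, eval_C, hcoeff, hQs]
        rw [mul_pow c _ (2 * (n + 1)), e1, e2, abs_of_nonneg]
        · convert h using 1 <;> ring
        · rw [pow_mul, pow_mul]; positivity
    have hq : (C ((n + 3) ^ 2 : ℝ) * Q ^ (n + 2)).natDegree ≤ (n + 2) * (δ + 1) :=
      (natDegree_C_mul_le _ _).trans (natDegree_pow_le_of_le _ hQd)
    rw [natDegree_mul, natDegree_pow, natDegree_pow, h1, ← hδ] at hdeg
    · nlinarith
    · exact pow_ne_zero _ hne1
    · exact pow_ne_zero _ hne0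

theorem natDegree_coeff_le_one (d : ℕ) : ∀ (F : ℝ[X][X]) (c : ℝ), c ≠ 0 → F.natDegree ≤ d →
    F.coeff d = C c → (1 ≤ d → (F.coeff (d - 1)).natDegree = 1) →
    (2 ≤ d → (F.coeff (d - 2)).natDegree ≤ 1) → (3 ≤ d → (F.coeff (d - 3)).natDegree ≤ 2) →
    (∀ s, (F.map (evalRingHom s)).Splits) → ∀ k, (F.coeff k).natDegree ≤ 1 := by
  induction d with
  | zero =>
    intro F c _ hd hlead _ _ _ _ k
    rcases Nat.eq_zero_or_pos k with rfl | hk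
    · simp [hlead]
    · simp [coeff_eq_zero_of_natDegree_lt (hd.trans_lt hk)]
  | succ d ih =>
    intro F c hc hd hlead h1 h2 h3 hs
    have hcast : ∀ (p : ℝ[X]) (m : ℕ), p * ((m : ℝ[X]) + 1) = C ((m : ℝ) + 1) * p := fun p m => by
      simp [mul_comm]
    have hne : ∀ m : ℕ, (m : ℝ) + 1 ≠ 0 := fun m => by positivity
    have hder : ∀ m, ((derivative F).coeff m).natDegree = (F.coeff (m + 1)).natDegree := fun m => by
      rw [coeff_derivative, hcast, natDegree_C_mul (hne m)]
    have hpos : ∀ k ≠ 0, (F.coeff k).natDegree ≤ 1 := by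
      intro k hk
      obtain ⟨k, rfl⟩ := Nat.exists_eq_succ_of_ne_zero hk
      rw [Nat.succ_eq_add_one, ← hder]
      refine ih (derivative F) ((d + 1) * c) (mul_ne_zero (hne d) hc)
        ((natDegree_derivative_le _).trans (by omega)) ?_ ?_ ?_ ?_ ?_ k
      · rw [coeff_derivative, hlead, hcast, ← C_mul]
      · intro h
        rw [hder, show d - 1 + 1 = d + 1 - 1 by omega]; exact h1 (by omega)
      · intro h
        rw [hder, show d - 2 + 1 = d + 1 - 2 by omega]; exact h2 (by omega)
      · intro h
        rw [hder, show d - 3 + 1 = d + 1 - 3 by omega]; exact h3 (by omega)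
      · intro s
        rw [← derivative_map]
        exact (hs s).derivative_real
    intro k
    rcases eq_or_ne k 0 with rfl | hk
    swap
    · exact hpos k hk
    match d, h1, h2, h3, hd, hlead with
    | 0, h1, _, _, _, _ => exact (h1 le_rfl).le
    | 1, _, h2, _, _, _ => exact h2 le_rfl
    | n + 2, h1, _, h3, hd, hlead =>
      refine natDegree_coeff_zero_le_one (c := c)
        (fun s => exists_roots_of_map_splits hc hd hlead (hs s)) (h1 (by omega)) hpos ?_
      rintro rfl
      exact h3 le_rfl

end RealRootedFamily

end Polynomial

section Hyperbolic

/-- The bivariate polynomial `h (y + s • u + t • e)` as an element of `ℝ[s][t]`. -/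
def planePoly {m : ℕ} (h : MvPolynomial (Fin m) ℝ) (e y u : Fin m → ℝ) :
    Polynomial (Polynomial ℝ) :=
  aeval (fun j => Polynomial.C (Polynomial.C (y j) + Polynomial.C (u j) * Polynomial.X) +
    Polynomial.C (Polynomial.C (e j)) * Polynomial.X) h

variable {m d : ℕ} {h : MvPolynomial (Fin m) ℝ} {e : Fin m → ℝ}

lemma eval_map_planePoly (y u : Fin m → ℝ) (s t : ℝ) :
    ((planePoly h e y u).map (Polynomial.evalRingHom s)).eval t =
      eval (y + s • u + t • e) h := by
  rw [planePoly]
  induction h using MvPolynomial.induction_on with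
  | C a => simp
  | add p q hp hq => rw [map_add, Polynomial.map_add, Polynomial.eval_add, hp, hq, map_add]
  | mul_X p j hp =>
    rw [map_mul, Polynomial.map_mul, Polynomial.eval_mul, hp, map_mul, aeval_X, eval_X]
    simp
    ring_nf
    simp

lemma eval_smul_of_isHomogeneous (hh : h.IsHomogeneous d) (a : ℝ) (x : Fin m → ℝ) :
    eval (a • x) h = a ^ d * eval x h := by
  rw [eval_eq', eval_eq', Finset.mul_sum]
  refine Finset.sum_congr rfl fun b hb => ?_
  have hb' : ∑ i, b i = d := by
    rw [← hh (mem_support_iff.1 hb), Finsupp.weight_apply, Finsupp.sum_fintype _ _ (by simp)]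
    simp
  simp only [Pi.smul_apply, smul_eq_mul, mul_pow, Finset.prod_mul_distrib, Finset.prod_pow_eq_pow_sum,
    hb']
  ring

lemma tendsto_eval_coeff_planePoly (hh : h.IsHomogeneous d) (y u : Fin m → ℝ) {k : ℕ}
    (hk : k ≤ d) :
    Filter.Tendsto (fun s => ((planePoly h e y u).coeff k).eval s / s ^ (d - k)) Filter.atTop
      (nhds (((planePoly h e u y).coeff k).eval 0)) := by
  have hlim : Filter.Tendsto (fun s : ℝ => ((planePoly h e u y).coeff k).eval s⁻¹) Filter.atTop
      (nhds (((planePoly h e u y).coeff k).eval 0)) :=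
    ((Polynomial.continuous _).tendsto 0).comp tendsto_inv_atTop_zero
  refine hlim.congr' ?_
  filter_upwards [Filter.eventually_gt_atTop 0] with s hs
  have hpoly : (planePoly h e y u).map (Polynomial.evalRingHom s) = Polynomial.C (s ^ d) *
      ((planePoly h e u y).map (Polynomial.evalRingHom s⁻¹)).comp
        (Polynomial.C s⁻¹ * Polynomial.X) := by
    refine Polynomial.funext fun t => ?_
    simp only [Polynomial.eval_mul, Polynomial.eval_C, Polynomial.eval_comp, Polynomial.eval_X,
      eval_map_planePoly]
    rw [← eval_smul_of_isHomogeneous hh]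
    congr 2
    ext j
    simp
    field_simp
    ring
  have hcoeff := congrArg (fun p => p.coeff k) hpoly
  simp only [Polynomial.coeff_map, Polynomial.coeff_C_mul, Polynomial.comp_C_mul_X_coeff,
    Polynomial.coe_evalRingHom] at hcoeff
  obtain ⟨l, rfl⟩ := Nat.exists_eq_add_of_le hk
  rw [hcoeff, Nat.add_sub_cancel_left, inv_pow, pow_add]
  generalize ((planePoly h e y u).coeff k).eval s⁻¹ = a
  field_simp

lemma exists_prod_X_sub_C_eq_of_hrank_le_one {n : ℕ} {lam : (Fin m → ℝ) → Fin (n + 1) → ℝ}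
    {v : Fin m → ℝ} (hv : hrank lam v ≤ 1) :
    ∃ μ : ℝ, ∏ i, (Polynomial.X - Polynomial.C (lam v i)) =
      Polynomial.X ^ n * (Polynomial.X - Polynomial.C μ) := by
  obtain ⟨i₀, hi₀⟩ : ∃ i₀, ∀ i ≠ i₀, lam v i = 0 := by
    rw [hrank, Finite.card_le_one_iff_subsingleton] at hv
    by_cases hall : ∀ i, lam v i = 0
    · exact ⟨0, fun i _ => hall i⟩
    · push Not at hall
      obtain ⟨i₀, h₀⟩ := hall
      refine ⟨i₀, fun i hi => by_contra fun hne => hi ?_⟩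
      simpa using hv.elim ⟨i, hne⟩ ⟨i₀, h₀⟩
  refine ⟨lam v i₀, ?_⟩
  rw [← Finset.prod_erase_mul univ _ (mem_univ i₀)]
  congr 1
  rw [Finset.prod_congr rfl (g := fun _ => Polynomial.X) fun i hi => by
    rw [hi₀ i (Finset.ne_of_mem_erase hi)]; simp]
  simp

/-- Along a direction of hyperbolic rank at most one, `h` restricts to affine functions. -/
theorem natDegree_coeff_zero_planePoly_le_one {lam : (Fin m → ℝ) → Fin d → ℝ}
    (hhyp : IsHyperbolic h e lam) {v : Fin m → ℝ} (hv : hrank lam v ≤ 1) (y : Fin m → ℝ) :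
    ((planePoly h e y (-v)).coeff 0).natDegree ≤ 1 := by
  obtain ⟨hh, hpos, -, hfac⟩ := hhyp
  set F := planePoly h e y (-v) with hF
  set c := eval e h with hc
  have hFs : ∀ s, F.map (Polynomial.evalRingHom s) =
      Polynomial.C c * ∏ i, (Polynomial.X - Polynomial.C (lam (s • v - y) i)) := fun s => by
    refine Polynomial.funext fun t => ?_
    rw [hF, eval_map_planePoly, show y + s • -v + t • e = t • e - (s • v - y) by module, hfac]
    simp [Polynomial.eval_prod]
  have hcoeff : ∀ s k, (F.coeff k).eval s =
      c * (∏ i, (Polynomial.X - Polynomial.C (lam (s • v - y) i))).coeff k := fun s k => by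
    rw [← Polynomial.coeff_C_mul, ← hFs, Polynomial.coeff_map, Polynomial.coe_evalRingHom]
  have hprodnat : ∀ r : Fin d → ℝ,
      (∏ i, (Polynomial.X - Polynomial.C (r i))).natDegree = d := fun r => by
    simp
  have hd : F.natDegree ≤ d := Polynomial.natDegree_le_iff_coeff_eq_zero.2 fun k hk =>
    Polynomial.funext fun s => by
      rw [hcoeff, Polynomial.coeff_eq_zero_of_natDegree_lt (by rwa [hprodnat])]; simp
  have hlead : F.coeff d = Polynomial.C c := Polynomial.funext fun s => by
    have := (Polynomial.monic_prod_X_sub_C (lam (s • v - y)) univ).coeff_natDegree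
    rw [hprodnat] at this
    rw [hcoeff, this]; simp
  have hG : ∀ k, ((planePoly h e (-v) y).coeff k).eval 0 =
      c * (∏ i, (Polynomial.X - Polynomial.C (lam v i))).coeff k := fun k => by
    rw [← Polynomial.coeff_C_mul, ← Polynomial.coe_evalRingHom, ← Polynomial.coeff_map]
    congr 1
    refine Polynomial.funext fun t => ?_
    rw [eval_map_planePoly, show -v + (0 : ℝ) • y + t • e = t • e - v by module, hfac]
    simp [Polynomial.eval_prod]
  have hdeg : ∀ k ≤ d, (F.coeff k).natDegree ≤ d - k ∧ (F.coeff k).coeff (d - k) =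
      c * (∏ i, (Polynomial.X - Polynomial.C (lam v i))).coeff k := fun k hk => by
    rw [← hG]
    exact Polynomial.of_tendsto_eval_div_pow (tendsto_eval_coeff_planePoly hh y (-v) hk)
  clear_value F
  rcases d with _ | n
  · simp [hlead]
  obtain ⟨μ, hμ⟩ := exists_prod_X_sub_C_eq_of_hrank_le_one hv
  rw [hμ] at hdeg
  have hlow : ∀ k < n, (F.coeff k).natDegree ≤ n - k := fun k hk => by
    obtain ⟨h1, h2⟩ := hdeg k (by omega)
    rw [Polynomial.coeff_X_pow_mul', if_neg (by omega), mul_zero] at h2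
    have h3 : (F.coeff k).natDegree ≠ n + 1 - k := fun h3 => by
      rw [← h3, Polynomial.coeff_natDegree, Polynomial.leadingCoeff_eq_zero] at h2
      rw [h2, Polynomial.natDegree_zero] at h3
      omega
    omega
  obtain ⟨hn1, hn2⟩ := hdeg n (by omega)
  have hsplit : ∀ s, (F.map (Polynomial.evalRingHom s)).Splits := fun s => by
    rw [hFs]
    exact (Polynomial.Splits.prod fun i _ => Polynomial.Splits.X_sub_C _).C_mul _
  rw [Nat.add_sub_cancel_left] at hn1 hn2
  by_cases hμ0 : μ = 0
  · rcases n with _ | n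
    · exact hn1
    · refine (Polynomial.natDegree_coeff_zero_eq_zero hpos.ne' (fun s => ⟨_, hFs s⟩) ?_
        ((hlow n (by omega)).trans (by omega))).le.trans zero_le_one
      refine Nat.lt_one_iff.1 (lt_of_le_of_ne hn1 fun h1 => ?_)
      have h3 : (F.coeff (n + 1)).coeff 1 = 0 := by
        rw [hn2, hμ0]
        simp [← pow_succ, Polynomial.coeff_X_pow]
      have h4 : F.coeff (n + 1) = 0 :=
        Polynomial.leadingCoeff_eq_zero.1 (by rw [Polynomial.leadingCoeff, h1, h3])
      rw [h4, Polynomial.natDegree_zero] at h1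
      exact zero_ne_one h1
  · refine Polynomial.natDegree_coeff_le_one (n + 1) F c hpos.ne' hd hlead ?_ ?_ ?_ hsplit 0
    · intro _
      rw [Nat.add_sub_cancel]
      refine le_antisymm hn1 (Polynomial.le_natDegree_of_ne_zero ?_)
      rw [hn2]
      simpa [Polynomial.coeff_X_pow_mul'] using ⟨hpos.ne', hμ0⟩
    · intro h2
      exact (hlow _ (by omega)).trans (by omega)
    · intro h3
      exact (hlow _ (by omega)).trans (by omega)

end Hyperbolic

section Shift

variable {n : ℕ}

lemma pderiv_pderiv_comm (i j : Fin n) (P : MvPolynomial (Fin n) ℝ) :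
    pderiv i (pderiv j P) = pderiv j (pderiv i P) := by
  induction P using MvPolynomial.induction_on with
  | C a => simp
  | add p q hp hq => simp only [map_add, hp, hq]
  | mul_X p k hp =>
    simp only [Derivation.leibniz, map_add, pderiv_X, smul_eq_mul, hp, Pi.single_apply]
    split_ifs <;> simp <;> ring

/-- The restriction of `P` to the line through `w` parallel to the `i`-th axis. -/
def axisPoly (P : MvPolynomial (Fin n) ℝ) (w : Fin n → ℝ) (i : Fin n) : Polynomial ℝ :=
  aeval (fun j => Polynomial.C (w j) + Polynomial.C (Pi.single (M := fun _ => ℝ) i 1 j) *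
    Polynomial.X) P

lemma eval_axisPoly (P : MvPolynomial (Fin n) ℝ) (w : Fin n → ℝ) (i : Fin n) (t : ℝ) :
    (axisPoly P w i).eval t = eval (w + t • Pi.single i 1) P := by
  rw [axisPoly]
  induction P using MvPolynomial.induction_on with
  | C a => simp
  | add p q hp hq => simp [hp, hq]
  | mul_X p j hp => simp [hp, mul_comm t]

lemma derivative_axisPoly (P : MvPolynomial (Fin n) ℝ) (w : Fin n → ℝ) (i : Fin n) :
    Polynomial.derivative (axisPoly P w i) = axisPoly (pderiv i P) w i := by
  simp only [axisPoly]
  induction P using MvPolynomial.induction_on with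
  | C a => simp
  | add p q hp hq => simp [hp, hq]
  | mul_X p j hp =>
    rw [map_mul, Polynomial.derivative_mul, hp, Derivation.leibniz, map_add, smul_eq_mul,
      smul_eq_mul, map_mul, map_mul, aeval_X, pderiv_X]
    rcases eq_or_ne i j with rfl | hij
    · simp only [Pi.single_eq_same, map_one, one_mul, Polynomial.derivative_add,
        Polynomial.derivative_C, Polynomial.derivative_X]
      ring
    · simp only [Pi.single_eq_of_ne hij.symm, map_zero, zero_mul,
        Polynomial.derivative_add, Polynomial.derivative_C]
      ring

lemma eval_add_smul_single {P : MvPolynomial (Fin n) ℝ} {i : Fin n}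
    (hP : pderiv i (pderiv i P) = 0) (w : Fin n → ℝ) (a : ℝ) :
    eval (w + a • Pi.single i 1) P = eval w P + a * eval w (pderiv i P) := by
  have h2 : Polynomial.derivative (axisPoly (pderiv i P) w i) = 0 := by
    rw [derivative_axisPoly, hP, axisPoly, map_zero]
  have h3 : axisPoly (pderiv i P) w i = Polynomial.C (eval w (pderiv i P)) := by
    rw [Polynomial.eq_C_of_natDegree_eq_zero (Polynomial.derivative_eq_zero.1 h2),
      Polynomial.coeff_zero_eq_eval_zero, eval_axisPoly]
    simp
  have h4 : Polynomial.derivative (axisPoly P w i -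
      Polynomial.C (eval w (pderiv i P)) * Polynomial.X) = 0 := by
    simp [derivative_axisPoly, h3]
  have h5 := Polynomial.eq_C_of_natDegree_eq_zero
    (Polynomial.derivative_eq_zero.1 h4)
  have h6 := congrArg (Polynomial.eval a) h5
  simp only [Polynomial.coeff_zero_eq_eval_zero, Polynomial.eval_sub, Polynomial.eval_mul,
    Polynomial.eval_C, Polynomial.eval_X, eval_axisPoly, zero_smul, add_zero, mul_zero,
    sub_zero] at h6
  linarith

/-- On multiaffine polynomials the operator `∏ (1 + ε ∂ᵢ)` is the shift by `ε ∑ eᵢ`. -/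
lemma eval_opSign (ε : ℝ) (L : List (Fin n)) (P : MvPolynomial (Fin n) ℝ)
    (hP : ∀ i, pderiv i (pderiv i P) = 0) (w : Fin n → ℝ) :
    eval w (opSign ε L P) = eval (w + ε • (L.map fun i => Pi.single i (1 : ℝ)).sum) P := by
  induction L generalizing P with
  | nil => simp [opSign]
  | cons i L ih =>
    have hP' : ∀ j, pderiv j (pderiv j (P + C ε * pderiv i P)) = 0 := fun j => by
      rw [map_add, map_add, hP j, pderiv_C_mul, pderiv_C_mul, pderiv_pderiv_comm j i,
        pderiv_pderiv_comm j i, hP j]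
      simp
    have := ih _ hP'
    rw [opSign, List.foldl_cons, ← opSign, this, List.map_cons, List.sum_cons, smul_add,
      add_comm (ε • _), ← add_assoc, eval_add_smul_single (hP i)]
    simp

end Shift

lemma eval_zPoly {m n : ℕ} (h : MvPolynomial (Fin m) ℝ) (x : Fin m → ℝ) (v : Fin n → Fin m → ℝ)
    (w : Fin n → ℝ) : eval w (zPoly h x v) = eval (x + ∑ i, w i • v i) h := by
  rw [zPoly]
  induction h using MvPolynomial.induction_on with
  | C a => simp [algebraMap_eq]
  | add p q hp hq => rw [map_add, map_add, hp, hq, map_add]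
  | mul_X p j hp =>
    rw [map_mul, map_mul, hp, map_mul, aeval_X, eval_X]
    simp

lemma pderiv_pderiv_zPoly {m d n : ℕ} {h : MvPolynomial (Fin m) ℝ} {e : Fin m → ℝ}
    {lam : (Fin m → ℝ) → Fin d → ℝ} (hhyp : IsHyperbolic h e lam) {v : Fin n → Fin m → ℝ}
    {i : Fin n} (hv : hrank lam (v i) ≤ 1) (x : Fin m → ℝ) :
    pderiv i (pderiv i (zPoly h x v)) = 0 := by
  refine MvPolynomial.funext fun w => ?_
  have hline : axisPoly (zPoly h x v) w i =
      ((planePoly h e (x + ∑ j, w j • v j) (-v i)).coeff 0).comp (-Polynomial.X) := by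
    refine Polynomial.funext fun t => ?_
    have h0 := eval_map_planePoly (h := h) (e := e) (x + ∑ j, w j • v j) (-v i) (-t) 0
    rw [← Polynomial.coeff_zero_eq_eval_zero, Polynomial.coeff_map,
      Polynomial.coe_evalRingHom] at h0
    rw [eval_axisPoly, eval_zPoly, Polynomial.eval_comp, Polynomial.eval_neg, Polynomial.eval_X, h0]
    congr 1
    simp [add_smul, Finset.sum_add_distrib, add_assoc, Pi.single_apply, ite_smul]
  have hdeg : (axisPoly (zPoly h x v) w i).natDegree ≤ 1 := by
    rw [hline, Polynomial.natDegree_comp]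
    simpa using natDegree_coeff_zero_planePoly_le_one hhyp hv (x + ∑ j, w j • v j)
  have hder : Polynomial.derivative (Polynomial.derivative (axisPoly (zPoly h x v) w i)) = 0 :=
    Polynomial.derivative_of_natDegree_zero
      (Nat.le_zero.1 ((Polynomial.natDegree_derivative_le _).trans (by omega)))
  rw [derivative_axisPoly, derivative_axisPoly] at hder
  have := congrArg (Polynomial.eval 0) hder
  rw [eval_axisPoly] at this
  simpa using this

/-- First-order expansion of a hyperbolic polynomial along rank-one directions. -/
theorem first_order_expansion
    {m d n : ℕ} (h : MvPolynomial (Fin m) ℝ) (e : Fin m → ℝ)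
    (lam : (Fin m → ℝ) → Fin d → ℝ)
    (hhyp : IsHyperbolic h e lam)
    (v : Fin n → Fin m → ℝ)
    (hvrank : ∀ i, hrank lam (v i) ≤ 1)
    (x : Fin m → ℝ) (ε : ℝ) (hε : ε = 1 ∨ ε = -1) :
    (eval (x + ε • ∑ i, v i) h
        = eval (0 : Fin n → ℝ) (opSign ε (List.finRange n) (zPoly h x v)))
    ∧ ∀ T : Finset (Fin n),
        eval (x + ε • ∑ i ∈ T, v i) h
          = eval (0 : Fin n → ℝ) (opSign ε T.toList (zPoly h x v)) := by
  have key : ∀ T : Finset (Fin n), ∀ L : List (Fin n),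
      (L.map fun i => (Pi.single i (1 : ℝ) : Fin n → ℝ)).sum = ∑ i ∈ T, Pi.single i 1 →
      eval (x + ε • ∑ i ∈ T, v i) h = eval (0 : Fin n → ℝ) (opSign ε L (zPoly h x v)) := by
    intro T L hL
    rw [eval_opSign ε L _ fun i => pderiv_pderiv_zPoly hhyp (hvrank i) x, hL, eval_zPoly]
    congr 2
    simp [Finset.sum_apply, Pi.single_apply, Finset.smul_sum, ite_smul]
  refine ⟨key univ _ ?_, fun T => key T _ ?_⟩
  · rw [← List.ofFn_eq_map, List.sum_ofFn]
  · rw [Finset.sum_map_toList]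
end
end

section
/- Let μ be a d_μ-homogeneous strongly Rayleigh probability distribution on subsets of [n] with generating polynomial g_μ, and for 1 ≤ k ≤ n let μ_k be the marginal distribution on the first k elements, μ_k(S) = Pr_{T∼μ}[T ∩ [k] = S] for S ⊆ [k]. Then for every S ⊆ [k] and every real x > 0, μ_k(S) = x^{|S| − d_μ} · ∏_{i∈S} ∂_{zᵢ} ∏_{i∈[k]∖S} (1 − x∂_{zᵢ}) g_μ(x·𝟏 + z)|_{z=0}. In particular, for every S ⊆ [n] and every real x > 0, μ(S) = x^{|S| − d_μ} · ∏_{i∈S} ∂_{zᵢ} ∏_{i∈[n]∖S} (1 − x∂_{zᵢ}) g_μ(x·𝟏 + z)|_{z=0}. -/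
open MvPolynomial Finset
open scoped Classical

noncomputable section

/-- generating polynomial of a distribution on subsets of `[n]`. -/
def genPoly {n : ℕ} (μ : Finset (Fin n) → ℝ) : MvPolynomial (Fin n) ℝ :=
  ∑ S : Finset (Fin n), C (μ S) * ∏ i ∈ S, X i

/-- `μ` is a probability distribution on subsets of `[n]`. -/
def IsProbDist {n : ℕ} (μ : Finset (Fin n) → ℝ) : Prop :=
  (∀ S, 0 ≤ μ S) ∧ ∑ S : Finset (Fin n), μ S = 1

/-- substitute `z i ↦ x + z i` in a polynomial in the variables `z`. -/
def shiftPoly {n : ℕ} (g : MvPolynomial (Fin n) ℝ) (x : ℝ) : MvPolynomial (Fin n) ℝ :=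
  aeval (fun i : Fin n => C x + X i) g

/-- apply the operator `∏_{i ∈ L} ∂_{z i}`. -/
def derivAll {n : ℕ} (L : List (Fin n)) (P : MvPolynomial (Fin n) ℝ) :
    MvPolynomial (Fin n) ℝ :=
  L.foldl (fun Q i => pderiv i Q) P

/-- apply the operator `∏_{i ∈ L} (1 - x ∂_{z i})`. -/
def oneMinusXDeriv {n : ℕ} (x : ℝ) (L : List (Fin n)) (P : MvPolynomial (Fin n) ℝ) :
    MvPolynomial (Fin n) ℝ :=
  L.foldl (fun Q i => Q - C x * pderiv i Q) P

theorem pderiv_prod_C_add_X {n : ℕ} (a : Fin n → ℝ) (T : Finset (Fin n)) (j : Fin n) :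
    pderiv j (∏ i ∈ T, (C (a i) + X i)) =
      if j ∈ T then ∏ i ∈ T.erase j, (C (a i) + X i) else 0 := by
  induction T using Finset.induction_on with
  | empty => simp
  | insert k T hk ih =>
    rw [Finset.prod_insert hk, Derivation.leibniz, ih]
    by_cases hjk : j = k
    · subst hjk
      simp [hk]
    · have hpd : pderiv j (C (a k) + X k) = 0 := by simp [pderiv_X, Ne.symm hjk]
      by_cases hjT : j ∈ T
      · simp [hpd, hjT, Finset.erase_insert_of_ne (Ne.symm hjk), Finset.prod_insert, hk]
      · simp [hpd, hjT, hjk]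

theorem derivAll_sum {n : ℕ} {ι : Type*} (L : List (Fin n)) (s : Finset ι)
    (f : ι → MvPolynomial (Fin n) ℝ) :
    derivAll L (∑ i ∈ s, f i) = ∑ i ∈ s, derivAll L (f i) := by
  induction L generalizing f with
  | nil => rfl
  | cons j L ih =>
    have h := ih fun i => pderiv j (f i)
    simp only [derivAll, List.foldl_cons, map_sum] at h ⊢
    exact h

theorem derivAll_C_mul {n : ℕ} (L : List (Fin n)) (c : ℝ) (P : MvPolynomial (Fin n) ℝ) :
    derivAll L (C c * P) = C c * derivAll L P := by
  induction L generalizing P with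
  | nil => rfl
  | cons j L ih =>
    have h := ih (pderiv j P)
    simp only [derivAll, List.foldl_cons, pderiv_C_mul] at h ⊢
    exact h

theorem oneMinusXDeriv_sum {n : ℕ} {ι : Type*} (x : ℝ) (L : List (Fin n)) (s : Finset ι)
    (f : ι → MvPolynomial (Fin n) ℝ) :
    oneMinusXDeriv x L (∑ i ∈ s, f i) = ∑ i ∈ s, oneMinusXDeriv x L (f i) := by
  induction L generalizing f with
  | nil => rfl
  | cons j L ih =>
    have h := ih fun i => f i - C x * pderiv j (f i)
    simp only [oneMinusXDeriv, List.foldl_cons, map_sum, Finset.mul_sum,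
      Finset.sum_sub_distrib] at h ⊢
    exact h

theorem oneMinusXDeriv_C_mul {n : ℕ} (x : ℝ) (L : List (Fin n)) (c : ℝ)
    (P : MvPolynomial (Fin n) ℝ) :
    oneMinusXDeriv x L (C c * P) = C c * oneMinusXDeriv x L P := by
  induction L generalizing P with
  | nil => rfl
  | cons j L ih =>
    have h := ih (P - C x * pderiv j P)
    simp only [oneMinusXDeriv, List.foldl_cons, pderiv_C_mul] at h ⊢
    rw [← h]
    congr 1
    ring

theorem derivAll_prod_C_add_X {n : ℕ} (a : Fin n → ℝ) (L : List (Fin n)) (hL : L.Nodup)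
    (T : Finset (Fin n)) :
    derivAll L (∏ i ∈ T, (C (a i) + X i)) =
      if L.toFinset ⊆ T then ∏ i ∈ T \ L.toFinset, (C (a i) + X i) else 0 := by
  induction L generalizing T with
  | nil => simp [derivAll]
  | cons j L ih =>
    obtain ⟨hj, hL⟩ := List.nodup_cons.mp hL
    have hstep : derivAll (j :: L) (∏ i ∈ T, (C (a i) + X i)) =
        derivAll L (pderiv j (∏ i ∈ T, (C (a i) + X i))) := rfl
    rw [hstep, pderiv_prod_C_add_X, List.toFinset_cons]
    by_cases hjT : j ∈ T
    · rw [if_pos hjT, ih hL, Finset.sdiff_insert, Finset.erase_sdiff_comm]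
      simp [Finset.subset_erase, Finset.insert_subset_iff, hjT, hj]
    · rw [if_neg hjT, if_neg fun h => hjT (h (Finset.mem_insert_self _ _))]
      simpa using derivAll_sum L (∅ : Finset ℕ) fun _ => (0 : MvPolynomial (Fin n) ℝ)

theorem oneMinusXDeriv_prod_C_add_X {n : ℕ} (x : ℝ) (L : List (Fin n)) (hL : L.Nodup)
    (a : Fin n → ℝ) (ha : ∀ j ∈ L, a j = x) (T : Finset (Fin n)) :
    oneMinusXDeriv x L (∏ i ∈ T, (C (a i) + X i)) =
      ∏ i ∈ T, (C (if i ∈ L then 0 else a i) + X i) := by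
  induction L generalizing a with
  | nil => simp [oneMinusXDeriv]
  | cons j L ih =>
    obtain ⟨hj, hL⟩ := List.nodup_cons.mp hL
    have hstep : (∏ i ∈ T, (C (a i) + X i)) - C x * pderiv j (∏ i ∈ T, (C (a i) + X i)) =
        ∏ i ∈ T, (C (Function.update a j 0 i) + X i) := by
      have hoff : ∀ U : Finset (Fin n), j ∉ U →
          ∏ i ∈ U, (C (Function.update a j 0 i) + X i) =
            ∏ i ∈ U, (C (a i) + X i : MvPolynomial (Fin n) ℝ) := fun U hU =>
        Finset.prod_congr rfl fun i hi => by
          rw [Function.update_of_ne (ne_of_mem_of_not_mem hi hU)]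
      rw [pderiv_prod_C_add_X]
      by_cases hjT : j ∈ T
      · rw [if_pos hjT, ← Finset.mul_prod_erase T _ hjT, ← Finset.mul_prod_erase T _ hjT,
          hoff _ (Finset.notMem_erase j T), ha j List.mem_cons_self]
        simp
        ring
      · rw [if_neg hjT, hoff T hjT]
        simp
    have h := ih hL (Function.update a j 0) fun i hi => by
      rw [Function.update_of_ne (ne_of_mem_of_not_mem hi hj)]
      exact ha i (List.mem_cons_of_mem _ hi)
    rw [← hstep] at h
    refine h.trans (Finset.prod_congr rfl fun i _ => ?_)
    by_cases hij : i = j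
    · subst hij
      simp
    · simp [hij]

theorem card_eq_of_genPoly_isHomogeneous {n : ℕ} {μ : Finset (Fin n) → ℝ} {d : ℕ}
    (h : (genPoly μ).IsHomogeneous d) {T : Finset (Fin n)} (hT : μ T ≠ 0) : T.card = d := by
  have hprod : ∀ S : Finset (Fin n), (∏ i ∈ S, X i : MvPolynomial (Fin n) ℝ) =
      monomial (Finsupp.indicator S fun _ _ => 1) 1 := fun S => by
    rw [monomial_eq, Finsupp.prod_of_support_subset _ (Finsupp.support_indicator_subset ..) _
      (by simp), C_1, one_mul]
    exact Finset.prod_congr rfl fun i hi => by simp [hi]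
  have hinj : ∀ S : Finset (Fin n), (Finsupp.indicator S fun _ _ => 1 : Fin n →₀ ℕ) =
      (Finsupp.indicator T fun _ _ => 1) ↔ S = T := fun S => by
    refine ⟨fun hST => Finset.ext fun i => ?_, fun hST => hST ▸ rfl⟩
    have := DFunLike.congr_fun hST i
    simp only [Finsupp.indicator_apply] at this
    by_cases h₁ : i ∈ S <;> by_cases h₂ : i ∈ T <;> simp_all
  have hcoeff : coeff (Finsupp.indicator T fun _ _ => 1) (genPoly μ) = μ T := by
    simp [genPoly, coeff_sum, hprod, coeff_C_mul, coeff_monomial, hinj]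
  have hdeg := h (hcoeff ▸ hT)
  rw [← hdeg, Finsupp.weight_apply, Finsupp.sum_of_support_subset _
    (Finsupp.support_indicator_subset ..) _ (by simp), Finset.card_eq_sum_ones]
  exact Finset.sum_congr rfl fun i hi => by simp [hi]

theorem eval_derivAll_oneMinusXDeriv_prod {n : ℕ} {K S : Finset (Fin n)} (hSK : S ⊆ K) (x : ℝ)
    (T : Finset (Fin n)) :
    eval (0 : Fin n → ℝ) (derivAll S.toList (oneMinusXDeriv x (K \ S).toList
      (∏ i ∈ T, (C x + X i)))) = if T ∩ K = S then x ^ (T.card - S.card) else 0 := by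
  rw [oneMinusXDeriv_prod_C_add_X x _ (Finset.nodup_toList _) (fun _ => x) (fun _ _ => rfl),
    derivAll_prod_C_add_X _ _ (Finset.nodup_toList _)]
  simp only [Finset.toList_toFinset, Finset.mem_toList]
  by_cases hST : S ⊆ T
  · rw [if_pos hST, eval_prod]
    by_cases hTK : T ∩ K = S
    · rw [if_pos hTK, ← Finset.card_sdiff_of_subset hST, ← Finset.prod_const]
      refine Finset.prod_congr rfl fun i hi => ?_
      have hi' : i ∉ K \ S := fun hiK => by
        obtain ⟨hiT, hiS⟩ := Finset.mem_sdiff.mp hi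
        exact hiS (hTK ▸ Finset.mem_inter.mpr ⟨hiT, (Finset.mem_sdiff.mp hiK).1⟩)
      simp [-Finset.mem_sdiff, hi']
    · rw [if_neg hTK]
      obtain ⟨i, hi, hiS⟩ := Finset.exists_of_ssubset
        ((Finset.subset_inter hST hSK).ssubset_of_ne (Ne.symm hTK))
      rw [Finset.mem_inter] at hi
      exact Finset.prod_eq_zero (i := i) (by simp [hi, hiS]) (by simp [hi, hiS])
  · rw [if_neg hST, if_neg, map_zero]
    rintro rfl
    exact hST Finset.inter_subset_left

theorem sum_filter_inter_eq_eval_derivAll {n : ℕ} (μ : Finset (Fin n) → ℝ) {d : ℕ}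
    (hhom : (genPoly μ).IsHomogeneous d) {K S : Finset (Fin n)} (hSK : S ⊆ K) {x : ℝ}
    (hx : x ≠ 0) :
    ∑ T ∈ Finset.univ.filter (fun T => T ∩ K = S), μ T = x ^ ((S.card : ℤ) - (d : ℤ)) *
      eval (0 : Fin n → ℝ) (derivAll S.toList (oneMinusXDeriv x (K \ S).toList
        (shiftPoly (genPoly μ) x))) := by
  have hshift : shiftPoly (genPoly μ) x =
      ∑ T : Finset (Fin n), C (μ T) * ∏ i ∈ T, (C x + X i) := by
    simp [shiftPoly, genPoly, map_sum, map_prod, algebraMap_eq]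
  rw [hshift, oneMinusXDeriv_sum, derivAll_sum, map_sum, Finset.mul_sum, Finset.sum_filter]
  refine Finset.sum_congr rfl fun T _ => ?_
  rw [oneMinusXDeriv_C_mul, derivAll_C_mul, map_mul, eval_C,
    eval_derivAll_oneMinusXDeriv_prod hSK]
  by_cases hTK : T ∩ K = S
  · rw [if_pos hTK, if_pos hTK]
    by_cases hT : μ T = 0
    · simp [hT]
    · have hle : S.card ≤ T.card := Finset.card_le_card (hTK ▸ Finset.inter_subset_left)
      rw [← card_eq_of_genPoly_isHomogeneous hhom hT, ← zpow_natCast, Nat.cast_sub hle,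
        mul_left_comm, ← zpow_add₀ hx]
      simp
  · simp [hTK]

/-- Marginals of a homogeneous strongly Rayleigh distribution are given by derivatives
of its generating polynomial. -/
theorem sr_marginal_formula
    {n : ℕ} (μ : Finset (Fin n) → ℝ) (hprob : IsProbDist μ)
    (hSR : RealStable (genPoly μ))
    (dμ : ℕ) (hhom : (genPoly μ).IsHomogeneous dμ) :
    (∀ k : ℕ, 1 ≤ k → k ≤ n → ∀ S : Finset (Fin n), (∀ i ∈ S, (i : ℕ) < k) →
      ∀ x : ℝ, 0 < x →
        ∑ T ∈ Finset.univ.filter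
            (fun T => T ∩ Finset.univ.filter (fun i : Fin n => (i : ℕ) < k) = S), μ T
          = x ^ ((S.card : ℤ) - (dμ : ℤ)) *
            eval (0 : Fin n → ℝ)
              (derivAll S.toList
                (oneMinusXDeriv x
                  ((Finset.univ.filter (fun i : Fin n => (i : ℕ) < k)) \ S).toList
                  (shiftPoly (genPoly μ) x))))
    ∧ ∀ S : Finset (Fin n), ∀ x : ℝ, 0 < x →
        μ S = x ^ ((S.card : ℤ) - (dμ : ℤ)) *
          eval (0 : Fin n → ℝ)
            (derivAll S.toList
              (oneMinusXDeriv x Sᶜ.toList (shiftPoly (genPoly μ) x))) := by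
  refine ⟨fun k _ _ S hS x hx => ?_, fun S x hx => ?_⟩
  · exact sum_filter_inter_eq_eval_derivAll μ hhom (fun i hi => by simpa using hS i hi) hx.ne'
  · have h := sum_filter_inter_eq_eval_derivAll μ hhom (Finset.subset_univ S) hx.ne'
    rw [← Finset.compl_eq_univ_sdiff] at h
    rw [← h]
    simp [Finset.filter_eq']
end
end
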